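/- arXiv:2209.08051 — 2 statements merged into one kernel-verified Lean document; each statement's English description precedes it below -/
import Mathlib

section
/- Let ħ > 0, n = n_A + n_B with n_A, n_B ≥ 1, and let Σ be a real symmetric positive definite 2n×2n matrix. The following are equivalent: (i) there exist real symmetric matrices Σ_A (of size 2n_A×2n_A) and Σ_B (of size 2n_B×2n_B) such that Σ_A + (iħ/2)J_A and Σ_B + (iħ/2)J_B are positive semidefinite Hermitian matrices and Σ − (Σ_A ⊕ Σ_B) is positive semidefinite; (ii) there exist S_A ∈ Sp(2n_A,ℝ) and S_B ∈ Sp(2n_B,ℝ) such that Σ − (ħ/2)(S_A S_Aᵀ ⊕ S_B S_Bᵀ) is positive semidefinite. -/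
open Matrix Complex
open scoped ComplexOrder

noncomputable section

/-- The standard symplectic matrix `[[0, I],[-I, 0]]` in the `z = (x,p)` ordering,
acting on a `2m`-dimensional phase space indexed by `Fin m ⊕ Fin m`. -/
def Jmat (m : ℕ) : Matrix (Fin m ⊕ Fin m) (Fin m ⊕ Fin m) ℝ :=
  Matrix.fromBlocks 0 1 (-1) 0

/-- A real matrix is symplectic (for the symplectic form `J`) if `Sᵀ J S = J`. -/
def IsSymplectic {ι : Type*} [Fintype ι] (J S : Matrix ι ι ℝ) : Prop :=
  Sᵀ * J * S = J

/-- The phase space `ℝ^{2n} = ℝ^{2n_A} ⊕ ℝ^{2n_B}` of the bipartite system `AB`. -/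
abbrev ABIdx (nA nB : ℕ) := (Fin nA ⊕ Fin nA) ⊕ (Fin nB ⊕ Fin nB)

/-- The symplectic form on `ℝ^{2n}` is the direct sum `J = J_A ⊕ J_B` of the symplectic
forms of the two subsystems. -/
def JAB (nA nB : ℕ) : Matrix (ABIdx nA nB) (ABIdx nA nB) ℝ :=
  Matrix.fromBlocks (Jmat nA) 0 0 (Jmat nB)

/-- The complexification of a real matrix. -/
def cplx {m : Type*} (A : Matrix m m ℝ) : Matrix m m ℂ :=
  A.map (fun x => (x : ℂ))

section SquareRoots

variable {n : Type*}

lemma Matrix.PosSemidef.transpose_eq {A : Matrix n n ℝ} (hA : A.PosSemidef) : Aᵀ = A := by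
  simpa [conjTranspose_eq_transpose_of_trivial] using hA.isHermitian.eq

variable [Fintype n]

open scoped MatrixOrder in
/-- A positive semidefinite real matrix has a positive semidefinite square root commuting with
everything that commutes with the matrix. -/
lemma Matrix.PosSemidef.exists_sqrt [DecidableEq n] {A : Matrix n n ℝ} (hA : A.PosSemidef) :
    ∃ B : Matrix n n ℝ, B.PosSemidef ∧ B * B = A ∧ ∀ C, Commute A C → Commute B C :=
  ⟨CFC.sqrt A, (CFC.sqrt_nonneg A).posSemidef, CFC.sqrt_mul_sqrt_self A hA.nonneg,
    fun _ h => h.cfcₙ_nnreal _⟩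

open scoped MatrixOrder in
lemma Matrix.PosSemidef.eq_of_mul_self_eq [DecidableEq n] {A B : Matrix n n ℝ}
    (hA : A.PosSemidef) (hB : B.PosSemidef) (h : A * A = B * B) : A = B := by
  rw [← CFC.sqrt_mul_self A hA.nonneg, h, CFC.sqrt_mul_self B hB.nonneg]

lemma Matrix.PosSemidef.congr_transpose {A : Matrix n n ℝ} (hA : A.PosSemidef)
    (B : Matrix n n ℝ) : (B * A * Bᵀ).PosSemidef := by
  simpa [conjTranspose_eq_transpose_of_trivial] using hA.mul_mul_conjTranspose_same B

/-- If `P` is symmetric with `P² ≤ 1`, then `P ≤ 1`. -/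
lemma Matrix.posSemidef_one_sub_of_mul_self [DecidableEq n] {P : Matrix n n ℝ} (hP : Pᵀ = P)
    (h : (1 - P * P).PosSemidef) : (1 - P).PosSemidef := by
  have h1 : ((1 - P) * (1 - P)).PosSemidef := by
    have := PosSemidef.one.congr_transpose (1 - P)
    simpa [hP] using this
  have h2 := (h.add h1).smul (show (0 : ℝ) ≤ 1 / 2 by norm_num)
  convert h2 using 1
  rw [show (1 - P * P) + (1 - P) * (1 - P) = (2 : ℝ) • (1 - P) by
    rw [two_smul]; noncomm_ring, smul_smul]
  norm_num

end SquareRoots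

section Complexification

variable {n : Type*}

@[simp] lemma cplx_transpose (A : Matrix n n ℝ) : (cplx A)ᵀ = cplx Aᵀ := rfl

@[simp] lemma cplx_add (A B : Matrix n n ℝ) : cplx (A + B) = cplx A + cplx B := by
  ext; simp [cplx]

@[simp] lemma cplx_neg (A : Matrix n n ℝ) : cplx (-A) = -cplx A := by
  ext; simp [cplx]

@[simp] lemma cplx_smul (c : ℝ) (A : Matrix n n ℝ) : cplx (c • A) = (c : ℂ) • cplx A := by
  ext; simp [cplx]

@[simp] lemma cplx_one [DecidableEq n] : cplx (1 : Matrix n n ℝ) = 1 := by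
  simp [cplx]

@[simp] lemma cplx_conjTranspose (A : Matrix n n ℝ) : (cplx A)ᴴ = cplx Aᵀ := by
  ext; simp [cplx, conjTranspose_apply]

/-- Transposing the uncertainty relation flips the sign of the antisymmetric part. -/
lemma posSemidef_cplx_sub {A B : Matrix n n ℝ} (hA : Aᵀ = A) (hB : Bᵀ = -B)
    (h : (cplx A + I • cplx B).PosSemidef) : (cplx A - I • cplx B).PosSemidef := by
  have := h.transpose
  simpa [hA, hB, sub_eq_add_neg] using this

variable [Fintype n]

@[simp] lemma cplx_mul (A B : Matrix n n ℝ) : cplx (A * B) = cplx A * cplx B := by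
  ext; simp [cplx, Matrix.mul_apply]

lemma cplx_mulVec (A : Matrix n n ℝ) (x : n → ℝ) :
    cplx A *ᵥ (fun i => (x i : ℂ)) = fun i => ((A *ᵥ x) i : ℂ) := by
  ext; simp [cplx, mulVec, dotProduct]

lemma ofReal_dotProduct (x y : n → ℝ) :
    star (fun i => (x i : ℂ)) ⬝ᵥ (fun i => (y i : ℂ)) = ((x ⬝ᵥ y : ℝ) : ℂ) := by
  simp [dotProduct]

lemma posSemidef_of_cplx {A : Matrix n n ℝ} (hA : (cplx A).PosSemidef) : A.PosSemidef := by
  refine PosSemidef.of_dotProduct_mulVec_nonneg ?_ fun x => ?_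
  · have h := hA.isHermitian.eq
    ext i j
    have := congrFun (congrFun h i) j
    simpa [cplx] using this
  · have h := hA.dotProduct_mulVec_nonneg (fun i => (x i : ℂ))
    rw [cplx_mulVec, ofReal_dotProduct] at h
    simpa using h

lemma posSemidef_one_add_mul_self [DecidableEq n] {B : Matrix n n ℝ} (hB : Bᵀ = -B)
    (h : (1 + I • cplx B).PosSemidef) : (1 + B * B).PosSemidef := by
  have h' : (1 - I • cplx B).PosSemidef := by
    have := posSemidef_cplx_sub (A := 1) (by simp) hB (by simpa using h)
    simpa using this
  set X : Matrix n n ℂ := I • cplx B with hX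
  have hXX : X * X = -(cplx (B * B)) := by
    simp [hX, smul_smul]
  have k1 := h.mul_mul_conjTranspose_same (1 - X)
  have k2 := h'.mul_mul_conjTranspose_same (1 + X)
  rw [h'.isHermitian.eq] at k1
  rw [h.isHermitian.eq] at k2
  have k := (k1.add k2).smul (show (0 : ℝ) ≤ 1 / 2 by norm_num)
  apply posSemidef_of_cplx
  convert k using 1
  rw [show (1 - X) * (1 + X) * (1 - X) + (1 + X) * (1 - X) * (1 + X) = (2 : ℝ) • (1 - X * X) by
    rw [two_smul]; noncomm_ring, smul_smul, hXX]
  norm_num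

end Complexification

section Symplectic

variable {m : ℕ}

lemma Jmat_transpose : (Jmat m)ᵀ = -Jmat m := by
  simp [Jmat, fromBlocks_transpose, fromBlocks_neg]

lemma Jmat_mul_self : Jmat m * Jmat m = -1 := by
  rw [← fromBlocks_one, fromBlocks_neg]
  simp [Jmat, fromBlocks_multiply]

lemma Jmat_mulVec_eq_zero {x : Fin m ⊕ Fin m → ℝ} (h : Jmat m *ᵥ x = 0) : x = 0 := by
  have := congrArg (Jmat m *ᵥ ·) h
  simpa [Jmat_mul_self, neg_mulVec] using this

lemma IsSymplectic.transpose_right {S : Matrix (Fin m ⊕ Fin m) (Fin m ⊕ Fin m) ℝ}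
    (h : IsSymplectic (Jmat m) S) : S * Jmat m * Sᵀ = Jmat m := by
  have h1 : (-(Jmat m) * Sᵀ * Jmat m) * S = 1 := by
    unfold IsSymplectic at h
    rw [Matrix.mul_assoc, Matrix.mul_assoc, ← Matrix.mul_assoc Sᵀ, h, Matrix.neg_mul,
      Jmat_mul_self, neg_neg]
  have h2 := mul_eq_one_comm.mp h1
  calc S * Jmat m * Sᵀ = -(S * Jmat m * Sᵀ * (Jmat m * Jmat m)) := by simp [Jmat_mul_self]
    _ = (S * (-(Jmat m) * Sᵀ * Jmat m)) * Jmat m := by simp [Matrix.mul_assoc]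
    _ = Jmat m := by rw [h2, Matrix.one_mul]

/-- `S Sᵀ` satisfies the uncertainty relation for symplectic `S`. -/
lemma IsSymplectic.uncertainty {S : Matrix (Fin m ⊕ Fin m) (Fin m ⊕ Fin m) ℝ}
    (h : IsSymplectic (Jmat m) S) : (cplx (S * Sᵀ) + I • cplx (Jmat m)).PosSemidef := by
  set X : Matrix (Fin m ⊕ Fin m) (Fin m ⊕ Fin m) ℂ := I • cplx (Jmat m) with hX
  have hXX : X * X = 1 := by
    simp [hX, smul_smul, ← cplx_mul, Jmat_mul_self]
  have hXh : Xᴴ = X := by simp [hX, Jmat_transpose]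
  have k := (posSemidef_self_mul_conjTranspose (1 + X)).smul (show (0 : ℝ) ≤ 1 / 2 by norm_num)
  have k1 : (1 + X).PosSemidef := by
    convert k using 1
    rw [conjTranspose_add, hXh, conjTranspose_one,
      show (1 + X) * (1 + X) = 1 + X * X + X + X by noncomm_ring, hXX,
      show (1 : Matrix (Fin m ⊕ Fin m) (Fin m ⊕ Fin m) ℂ) + 1 + X + X = (2 : ℝ) • (1 + X) by
        rw [two_smul]; abel, smul_smul]
    norm_num
  have k2 := k1.mul_mul_conjTranspose_same (cplx S)
  convert k2 using 1
  conv_lhs => rw [hX, ← h.transpose_right]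
  simp [hX, Matrix.mul_add, Matrix.add_mul]

/-- A real symmetric matrix satisfying the uncertainty relation is positive definite. -/
lemma posDef_of_uncertainty {c : ℝ} (hc : 0 < c)
    {A : Matrix (Fin m ⊕ Fin m) (Fin m ⊕ Fin m) ℝ} (hA : Aᵀ = A)
    (h : (cplx A + I • cplx (c • Jmat m)).PosSemidef) : A.PosDef := by
  have h' := posSemidef_cplx_sub hA (by simp [Jmat_transpose]) h
  have hpsd : A.PosSemidef := by
    apply posSemidef_of_cplx
    convert (h.add h').smul (show (0 : ℝ) ≤ 1 / 2 by norm_num) using 1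
    rw [show cplx A + I • cplx (c • Jmat m) + (cplx A - I • cplx (c • Jmat m))
      = (2 : ℝ) • cplx A by rw [two_smul]; abel, smul_smul]
    norm_num
  refine PosDef.of_dotProduct_mulVec_pos hpsd.isHermitian fun x hx => ?_
  refine lt_of_le_of_ne (hpsd.dotProduct_mulVec_nonneg x) fun h0 => hx ?_
  have hAx : A *ᵥ x = 0 := (hpsd.dotProduct_mulVec_zero_iff x).mp h0.symm
  have hJx : x ⬝ᵥ (Jmat m *ᵥ x) = 0 := by
    have : x ⬝ᵥ (Jmat m *ᵥ x) = -(x ⬝ᵥ (Jmat m *ᵥ x)) := by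
      conv_lhs => rw [dotProduct_mulVec, ← mulVec_transpose, Jmat_transpose, neg_mulVec,
        neg_dotProduct, dotProduct_comm]
    linarith
  have hz := (h.dotProduct_mulVec_zero_iff (fun i => (x i : ℂ))).mp (by
    rw [add_mulVec, smul_mulVec, dotProduct_add, dotProduct_smul, cplx_mulVec, cplx_mulVec,
      ofReal_dotProduct, ofReal_dotProduct, hAx, smul_mulVec, dotProduct_smul, hJx]
    simp)
  rw [add_mulVec, smul_mulVec, cplx_mulVec, cplx_mulVec, hAx] at hz
  apply Jmat_mulVec_eq_zero
  ext i
  have := congrFun hz i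
  simpa [smul_mulVec, hc.ne'] using this

/-- The positive square root of a positive symplectic matrix is symplectic. -/
lemma exists_isSymplectic_sqrt {K : Matrix (Fin m ⊕ Fin m) (Fin m ⊕ Fin m) ℝ}
    (hK : K.PosSemidef) (hKJ : K * Jmat m * K = Jmat m) :
    ∃ S, IsSymplectic (Jmat m) S ∧ S * Sᵀ = K := by
  obtain ⟨S, hS, hSS, -⟩ := hK.exists_sqrt
  refine ⟨S, ?_, by rw [hS.transpose_eq, hSS]⟩
  have hKinv : K * (Jmat m * K * (Jmat m)ᵀ) = 1 := by
    rw [← Matrix.mul_assoc, ← Matrix.mul_assoc, hKJ, Jmat_transpose, Matrix.mul_neg,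
      Jmat_mul_self, neg_neg]
  have hunit : IsUnit S := by
    have : S * (S * (Jmat m * K * (Jmat m)ᵀ)) = 1 := by
      rw [← Matrix.mul_assoc, hSS, hKinv]
    exact IsUnit.of_mul_eq_one _ this
  have hdet := (isUnit_iff_isUnit_det S).mp hunit
  have hJtJ : (Jmat m)ᵀ * Jmat m = 1 := by
    rw [Jmat_transpose, Matrix.neg_mul, Jmat_mul_self, neg_neg]
  have key : Jmat m * S * (Jmat m)ᵀ = S⁻¹ := by
    refine (hS.congr_transpose _).eq_of_mul_self_eq hS.inv ?_
    have e1 : S⁻¹ * S⁻¹ = Jmat m * K * (Jmat m)ᵀ := by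
      rw [← Matrix.mul_inv_rev, hSS]
      exact inv_eq_right_inv hKinv
    rw [e1, ← hSS]
    calc _ = Jmat m * S * ((Jmat m)ᵀ * Jmat m) * S * (Jmat m)ᵀ := by simp [Matrix.mul_assoc]
      _ = _ := by rw [hJtJ]; simp [Matrix.mul_assoc]
  unfold IsSymplectic
  rw [hS.transpose_eq]
  calc S * Jmat m * S = S * (Jmat m * S * ((Jmat m)ᵀ * Jmat m)) := by
        rw [hJtJ]; simp [Matrix.mul_assoc]
    _ = S * (Jmat m * S * (Jmat m)ᵀ) * Jmat m := by simp [Matrix.mul_assoc]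
    _ = Jmat m := by rw [key, mul_nonsing_inv _ hdet, Matrix.one_mul]

/-- A quantum covariance matrix dominates that of a pure Gaussian state. -/
lemma exists_isSymplectic_le {c : ℝ} (hc : 0 < c)
    {A : Matrix (Fin m ⊕ Fin m) (Fin m ⊕ Fin m) ℝ} (hA : Aᵀ = A)
    (h : (cplx A + I • cplx (c • Jmat m)).PosSemidef) :
    ∃ S, IsSymplectic (Jmat m) S ∧ (A - c • (S * Sᵀ)).PosSemidef := by
  have hpd := posDef_of_uncertainty hc hA h
  obtain ⟨R, hR, hRR, -⟩ := hpd.posSemidef.exists_sqrt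
  have hRu : IsUnit R := by
    have hdet := (isUnit_iff_isUnit_det A).mp hpd.isUnit
    refine IsUnit.of_mul_eq_one (R * A⁻¹) ?_
    rw [← Matrix.mul_assoc, hRR, mul_nonsing_inv _ hdet]
  have hRd := (isUnit_iff_isUnit_det R).mp hRu
  set Q := R⁻¹ with hQ
  have hRQ : R * Q = 1 := mul_nonsing_inv _ hRd
  have hQR : Q * R = 1 := nonsing_inv_mul _ hRd
  have hQt : Qᵀ = Q := hR.inv.transpose_eq
  set B := Q * (c • Jmat m) * Q with hB
  have hBt : Bᵀ = -B := by
    simp [hB, hQt, Jmat_transpose, Matrix.mul_assoc]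
  have hB1 : (1 + I • cplx B).PosSemidef := by
    have := h.mul_mul_conjTranspose_same (cplx Q)
    convert this using 1
    have e : Q * A * Q = 1 := by
      rw [← hRR, ← Matrix.mul_assoc, hQR, Matrix.one_mul, hRQ]
    rw [← cplx_one, ← e, hB]
    simp [hQt, Matrix.mul_add, Matrix.add_mul]
  have hT : (-(B * B)).PosSemidef := by
    have := PosSemidef.one.congr_transpose B
    simpa [hBt] using this
  obtain ⟨P, hP, hPP, hPcomm⟩ := hT.exists_sqrt
  have hP1 : (1 - P).PosSemidef :=
    posSemidef_one_sub_of_mul_self hP.transpose_eq (by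
      rw [hPP, sub_neg_eq_add]
      exact posSemidef_one_add_mul_self hBt hB1)
  set N := R * Jmat m * R with hN
  have hBN : B * N = -(c • 1) := by
    calc B * N = c • (Q * Jmat m * (Q * R) * Jmat m * R) := by
          simp [hB, hN, Matrix.mul_assoc]
      _ = c • (Q * (Jmat m * Jmat m) * R) := by rw [hQR]; simp [Matrix.mul_assoc]
      _ = _ := by rw [Jmat_mul_self]; simp [hQR]
  have hNB : N * B = -(c • 1) := by
    calc N * B = c • (R * Jmat m * (R * Q) * Jmat m * Q) := by
          simp [hB, hN, Matrix.mul_assoc]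
      _ = c • (R * (Jmat m * Jmat m) * Q) := by rw [hRQ]; simp [Matrix.mul_assoc]
      _ = _ := by rw [Jmat_mul_self]; simp [hRQ]
  have hcomm : Commute B N := hBN.trans hNB.symm
  have hPN : P * N = N * P := hPcomm N (hcomm.mul_left hcomm).neg_left
  have hPNP : P * N * P = c • B := by
    calc P * N * P = N * (P * P) := by rw [hPN, Matrix.mul_assoc]
      _ = -((N * B) * B) := by rw [hPP]; simp [Matrix.mul_assoc]
      _ = c • B := by rw [hNB]; simp
  have hRPR : (R * P * R).PosSemidef := by
    simpa [hR.transpose_eq] using hP.congr_transpose R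
  obtain ⟨S, hS, hSK⟩ := exists_isSymplectic_sqrt (K := c⁻¹ • (R * P * R))
    (hRPR.smul (inv_nonneg.mpr hc.le)) (by
      calc _ = (c⁻¹ * c⁻¹) • (R * (P * N * P) * R) := by
            simp [hN, Matrix.mul_assoc, smul_smul]
        _ = (c⁻¹ * c⁻¹ * c * c) • ((R * Q) * Jmat m * (Q * R)) := by
            rw [hPNP]; simp [hB, smul_smul, mul_assoc]
        _ = Jmat m := by
            rw [hRQ, hQR, show c⁻¹ * c⁻¹ * c * c = 1 by field_simp]; simp)
  refine ⟨S, hS, ?_⟩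
  rw [hSK, smul_smul, mul_inv_cancel₀ hc.ne', one_smul]
  have := hP1.congr_transpose R
  simpa [hR.transpose_eq, Matrix.mul_sub, Matrix.sub_mul, hRR] using this

end Symplectic

lemma Matrix.PosSemidef.fromBlocks_diag {m n : Type*} [Fintype m] [Fintype n]
    {A : Matrix m m ℝ} {B : Matrix n n ℝ} (hA : A.PosSemidef) (hB : B.PosSemidef) :
    (fromBlocks A 0 0 B).PosSemidef := by
  refine PosSemidef.of_dotProduct_mulVec_nonneg ?_ fun x => ?_
  · exact IsHermitian.fromBlocks hA.isHermitian (by simp) hB.isHermitian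
  · have h := add_nonneg (hA.dotProduct_mulVec_nonneg (x ∘ Sum.inl))
      (hB.dotProduct_mulVec_nonneg (x ∘ Sum.inr))
    simpa [fromBlocks_mulVec, dotProduct, Fintype.sum_sum_type] using h

/-- (Werner–Wolf separability criterion, reformulated.) For a real
symmetric positive definite `Σ` on the bipartite phase space, the existence of quantum
covariance matrices `Σ_A, Σ_B` with `Σ ≥ Σ_A ⊕ Σ_B` is equivalent to the existence of
symplectic matrices `S_A, S_B` with `Σ ≥ (ħ/2)(S_A S_Aᵀ ⊕ S_B S_Bᵀ)`. -/
theorem toeplitz_stmt7 (nA nB : ℕ) (hnA : 1 ≤ nA) (hnB : 1 ≤ nB)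
    (hbar : ℝ) (hhbar : 0 < hbar)
    (Sg : Matrix (ABIdx nA nB) (ABIdx nA nB) ℝ)
    (hSg : Sg.IsSymm) (hpos : Sg.PosDef) :
    (∃ SgA : Matrix (Fin nA ⊕ Fin nA) (Fin nA ⊕ Fin nA) ℝ,
     ∃ SgB : Matrix (Fin nB ⊕ Fin nB) (Fin nB ⊕ Fin nB) ℝ,
        SgA.IsSymm ∧ SgB.IsSymm ∧
        (cplx SgA + (Complex.I * (hbar / 2)) • cplx (Jmat nA)).PosSemidef ∧
        (cplx SgB + (Complex.I * (hbar / 2)) • cplx (Jmat nB)).PosSemidef ∧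
        (Sg - Matrix.fromBlocks SgA 0 0 SgB).PosSemidef) ↔
    (∃ SA : Matrix (Fin nA ⊕ Fin nA) (Fin nA ⊕ Fin nA) ℝ,
     ∃ SB : Matrix (Fin nB ⊕ Fin nB) (Fin nB ⊕ Fin nB) ℝ,
        IsSymplectic (Jmat nA) SA ∧ IsSymplectic (Jmat nB) SB ∧
        (Sg - (hbar / 2) • Matrix.fromBlocks (SA * SAᵀ) 0 0 (SB * SBᵀ)).PosSemidef) := by
  have hc : 0 < hbar / 2 := by positivity
  have hcplx : ∀ (m : ℕ) (A : Matrix (Fin m ⊕ Fin m) (Fin m ⊕ Fin m) ℝ),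
      cplx A + (Complex.I * (hbar / 2)) • cplx (Jmat m)
        = cplx A + I • cplx ((hbar / 2) • Jmat m) := by
    intro m A
    simp [smul_smul]
  simp only [hcplx]
  constructor
  · rintro ⟨SgA, SgB, hA, hB, hAu, hBu, h⟩
    obtain ⟨SA, hSA, hSA'⟩ := exists_isSymplectic_le hc hA hAu
    obtain ⟨SB, hSB, hSB'⟩ := exists_isSymplectic_le hc hB hBu
    refine ⟨SA, SB, hSA, hSB, ?_⟩
    convert h.add (hSA'.fromBlocks_diag hSB') using 1
    rw [fromBlocks_smul, sub_add, sub_right_inj, sub_eq_add_neg, fromBlocks_neg, fromBlocks_add]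
    simp
  · rintro ⟨SA, SB, hSA, hSB, h⟩
    have huncert : ∀ (m : ℕ) (S : Matrix (Fin m ⊕ Fin m) (Fin m ⊕ Fin m) ℝ),
        IsSymplectic (Jmat m) S → (cplx ((hbar / 2) • (S * Sᵀ))
          + I • cplx ((hbar / 2) • Jmat m)).PosSemidef := by
      intro m S hS
      convert hS.uncertainty.smul hc.le using 1
      rw [cplx_smul, cplx_smul, smul_add, smul_comm I]
      rfl
    refine ⟨(hbar / 2) • (SA * SAᵀ), (hbar / 2) • (SB * SBᵀ), ?_, ?_, huncert _ _ hSA,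
      huncert _ _ hSB, ?_⟩
    · simp [Matrix.IsSymm]
    · simp [Matrix.IsSymm]
    · simpa [fromBlocks_smul] using h
end
end

section
/- Let ħ > 0, let a ∈ L¹(ℝ²ⁿ), let φ₀(x) = (πħ)^{-n/4} e^{−|x|²/(2ħ)} be the standard Gaussian, and let ψ, χ be Schwartz functions on ℝⁿ. Then ∫_{ℝ²ⁿ} a(z) (ψ | T̂(z)φ₀)_{L²} · conj((χ | T̂(z)φ₀)_{L²}) dz = ∫_{ℝ²ⁿ} b(w) · W(ψ,χ)(w) dw, where b(w) = 2ⁿ ∫_{ℝ²ⁿ} e^{−|w−w'|²/ħ} a(w') dw'. (This expresses that the anti-Wick operator Op_AW(a) = ∫ a(z) Π̂₀(z) dz, with Π̂₀(z) the orthogonal projection onto ℂ·T̂(z)φ₀, is the Weyl operator with symbol b = (2πħ)ⁿ (a ∗ Wφ₀).) -/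
open MeasureTheory Matrix Complex

noncomputable section

/-- The `ħ`-dependent cross-Wigner transform
`W(ψ,φ)(x,p) = (2πħ)^{-n} ∫ e^{-ip·y/ħ} ψ(x+y/2) conj(φ(x-y/2)) dy` on `ℝⁿ`. -/
def crossWigner (n : ℕ) (hbar : ℝ) (ψ φ : (Fin n → ℝ) → ℂ) (x p : Fin n → ℝ) : ℂ :=
  ((2 * Real.pi * hbar) ^ n)⁻¹ *
    ∫ y : Fin n → ℝ,
      Complex.exp (-(Complex.I * (((p ⬝ᵥ y) / hbar : ℝ) : ℂ))) *
        ψ (x + y / 2) * (starRingEnd ℂ) (φ (x - y / 2))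

/-- The Heisenberg displacement operator
`T̂(z₀)φ(x) = e^{(i/ħ)(p₀·x - p₀·x₀/2)} φ(x - x₀)`, `z₀ = (x₀,p₀)`. -/
def heisenberg (n : ℕ) (hbar : ℝ) (z₀ : (Fin n → ℝ) × (Fin n → ℝ))
    (φ : (Fin n → ℝ) → ℂ) (x : Fin n → ℝ) : ℂ :=
  Complex.exp (Complex.I * (((z₀.2 ⬝ᵥ x - z₀.2 ⬝ᵥ z₀.1 / 2) / hbar : ℝ) : ℂ)) *
    φ (x - z₀.1)

/-- The standard (normalized) Gaussian `φ₀(x) = (πħ)^{-n/4} e^{-|x|²/(2ħ)}` on `ℝⁿ`. -/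
def stdGauss (n : ℕ) (hbar : ℝ) (x : Fin n → ℝ) : ℂ :=
  (((Real.pi * hbar) ^ (-(n : ℝ) / 4) : ℝ) : ℂ) *
    Complex.exp (-(((x ⬝ᵥ x) / (2 * hbar) : ℝ) : ℂ))

/-- The Gaussian kernel `e^{-|x|²/ħ}` on `ℝⁿ`. -/
def gaussKernel (n : ℕ) (hbar : ℝ) (x : Fin n → ℝ) : ℂ :=
  Complex.exp (-(((x ⬝ᵥ x) / hbar : ℝ) : ℂ))

lemma continuous_gaussKernel (n : ℕ) (hbar : ℝ) : Continuous (gaussKernel n hbar) := by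
  unfold gaussKernel dotProduct
  fun_prop

lemma norm_gaussKernel_le_one (n : ℕ) {hbar : ℝ} (hhbar : 0 < hbar) (x : Fin n → ℝ) :
    ‖gaussKernel n hbar x‖ ≤ 1 := by
  have h : 0 ≤ (x ⬝ᵥ x) / hbar :=
    div_nonneg (Finset.sum_nonneg fun i _ => mul_self_nonneg _) hhbar.le
  rw [gaussKernel, Complex.norm_exp, Complex.neg_re, Complex.ofReal_re, Real.exp_le_one_iff]
  linarith

lemma gaussKernel_mul_cexp_eq (n : ℕ) {hbar : ℝ} (c : Fin n → ℂ) (x : Fin n → ℝ) :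
    gaussKernel n hbar x * Complex.exp (∑ i, c i * x i)
      = Complex.exp (-(1 / hbar : ℂ) * ∑ i, (x i : ℂ) ^ 2 + ∑ i, c i * x i) := by
  rw [gaussKernel, ← Complex.exp_add]
  congr 2
  simp only [dotProduct]
  push_cast
  rw [neg_mul, ← Finset.sum_congr rfl fun i _ => pow_two (x i : ℂ)]
  ring

lemma one_div_ofReal_re_pos {hbar : ℝ} (hhbar : 0 < hbar) : 0 < (1 / hbar : ℂ).re := by
  rw [← Complex.ofReal_one, ← Complex.ofReal_div, Complex.ofReal_re]
  positivity

lemma integrable_gaussKernel (n : ℕ) {hbar : ℝ} (hhbar : 0 < hbar) :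
    Integrable (gaussKernel n hbar) := by
  have h := GaussianFourier.integrable_cexp_neg_mul_sum_add (ι := Fin n)
    (one_div_ofReal_re_pos hhbar) 0
  refine h.congr (Filter.Eventually.of_forall fun x => ?_)
  simpa using (gaussKernel_mul_cexp_eq n 0 x).symm

/-- The Fourier transform of a translated Gaussian. -/
lemma integral_gaussKernel_sub_mul_cexp (n : ℕ) {hbar : ℝ} (hhbar : 0 < hbar)
    (q y : Fin n → ℝ) :
    ∫ p : Fin n → ℝ, gaussKernel n hbar (p - q) *
        Complex.exp (-(Complex.I * (((p ⬝ᵥ y) / hbar : ℝ) : ℂ)))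
      = (((Real.pi * hbar) ^ ((n : ℝ) / 2) : ℝ) : ℂ) *
        (Complex.exp (-(Complex.I * (((q ⬝ᵥ y) / hbar : ℝ) : ℂ))) *
          gaussKernel n (4 * hbar) y) := by
  have hne : (hbar : ℂ) ≠ 0 := by exact_mod_cast hhbar.ne'
  have hshift : ∀ p : Fin n → ℝ, gaussKernel n hbar (p - q) *
        Complex.exp (-(Complex.I * (((p ⬝ᵥ y) / hbar : ℝ) : ℂ)))
      = (fun r : Fin n → ℝ => Complex.exp (-(Complex.I * (((q ⬝ᵥ y) / hbar : ℝ) : ℂ))) *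
          Complex.exp (-(1 / hbar : ℂ) * ∑ i, (r i : ℂ) ^ 2
            + ∑ i, (-(Complex.I * y i / hbar)) * r i)) (p - q) := by
    intro p
    dsimp only
    rw [← gaussKernel_mul_cexp_eq, mul_left_comm, ← Complex.exp_add]
    congr 2
    have hp : p ⬝ᵥ y = q ⬝ᵥ y + (p - q) ⬝ᵥ y := by rw [← add_dotProduct]; simp
    have hs : ∑ i, (-(Complex.I * y i / hbar)) * ((p - q) i : ℂ)
        = -(Complex.I * ((((p - q) ⬝ᵥ y) / hbar : ℝ) : ℂ)) := by
      simp only [dotProduct]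
      push_cast
      rw [Finset.sum_div, Finset.mul_sum, ← Finset.sum_neg_distrib]
      refine Finset.sum_congr rfl fun i _ => ?_
      ring
    rw [hs, hp]
    push_cast
    ring
  rw [integral_congr_ae (Filter.Eventually.of_forall hshift),
    integral_sub_right_eq_self (μ := volume) (fun r : Fin n → ℝ =>
      Complex.exp (-(Complex.I * (((q ⬝ᵥ y) / hbar : ℝ) : ℂ))) *
          Complex.exp (-(1 / hbar : ℂ) * ∑ i, (r i : ℂ) ^ 2
            + ∑ i, (-(Complex.I * y i / hbar)) * r i)) q,
    integral_const_mul,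
    GaussianFourier.integral_cexp_neg_mul_sum_add (one_div_ofReal_re_pos hhbar)]
  have h1 : (Real.pi / (1 / hbar : ℂ)) ^ (Fintype.card (Fin n) / 2 : ℂ)
      = (((Real.pi * hbar) ^ ((n : ℝ) / 2) : ℝ) : ℂ) := by
    rw [Complex.ofReal_cpow (by positivity)]
    simp
  have h2 : (∑ i, (-(Complex.I * y i / hbar)) ^ 2) / (4 * (1 / hbar : ℂ))
      = -(((y ⬝ᵥ y) / (4 * hbar) : ℝ) : ℂ) := by
    simp only [dotProduct]
    push_cast
    rw [Finset.sum_div, Finset.sum_div, ← Finset.sum_neg_distrib]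
    refine Finset.sum_congr rfl fun i _ => ?_
    field_simp
    rw [Complex.I_sq]
    ring
  rw [h1, h2, gaussKernel]
  ring

/-- Passing to centre and relative coordinates preserves Lebesgue measure. -/
lemma measurePreserving_add_half_sub_half (n : ℕ) :
    MeasurePreserving (fun q : (Fin n → ℝ) × (Fin n → ℝ) => (q.1 + q.2 / 2, q.1 - q.2 / 2))
      volume volume := by
  have hswap : MeasurePreserving (Prod.swap : (Fin n → ℝ) × (Fin n → ℝ) → _) volume volume :=
    Measure.measurePreserving_swap
  have h1 : MeasurePreserving (fun q : (Fin n → ℝ) × (Fin n → ℝ) => (q.1, q.2 + q.1 / 2))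
      volume volume :=
    (MeasurePreserving.id volume).skew_product (g := fun y x => x + y / 2)
      (by unfold Function.uncurry; fun_prop)
      (Filter.Eventually.of_forall fun y => (measurePreserving_add_right volume (y / 2)).map_eq)
  have h2 : MeasurePreserving (fun q : (Fin n → ℝ) × (Fin n → ℝ) => (q.1, q.1 - q.2))
      volume volume :=
    (MeasurePreserving.id volume).skew_product (g := fun u y => u - y)
      (by unfold Function.uncurry; fun_prop)
      (Filter.Eventually.of_forall fun u => (Measure.measurePreserving_sub_left volume u).map_eq)
  convert h2.comp (hswap.comp (h1.comp hswap)) using 1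
  funext q
  refine Prod.ext rfl ?_
  funext i
  simp
  ring

lemma exists_norm_schwartz_le {n : ℕ} (ψ : SchwartzMap (Fin n → ℝ) ℂ) :
    ∃ C, ∀ x, ‖ψ x‖ ≤ C :=
  ⟨‖ψ.toBoundedContinuousFunction‖, fun x => ψ.toBoundedContinuousFunction.norm_coe_le_norm x⟩

lemma integrable_schwartz_half {n : ℕ} (χ : SchwartzMap (Fin n → ℝ) ℂ) :
    Integrable fun t : Fin n → ℝ => χ ((2⁻¹ : ℝ) • t) :=
  χ.integrable.comp_smul (by norm_num)

lemma sub_half_eq {n : ℕ} (x y : Fin n → ℝ) :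
    x - y / 2 = (2⁻¹ : ℝ) • ((2 : ℝ) • x - y) := by
  funext i
  simp
  ring

lemma norm_cexp_neg_I_mul (t : ℝ) : ‖Complex.exp (-(Complex.I * (t : ℂ)))‖ = 1 := by
  rw [← mul_neg, ← Complex.ofReal_neg, mul_comm, Complex.norm_exp_ofReal_mul_I]

/-- The integrand of the cross-Wigner transform is integrable for fixed `x`. -/
lemma integrable_schwartz_mul_conj {n : ℕ} (ψ χ : SchwartzMap (Fin n → ℝ) ℂ)
    (x : Fin n → ℝ) :
    Integrable fun y : Fin n → ℝ => ψ (x + y / 2) * (starRingEnd ℂ) (χ (x - y / 2)) := by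
  obtain ⟨C, hC⟩ := exists_norm_schwartz_le ψ
  have h : Integrable fun y : Fin n → ℝ => χ (x - y / 2) := by
    simp_rw [sub_half_eq]
    exact (integrable_schwartz_half χ).comp_sub_left _
  have hc : Integrable fun y : Fin n → ℝ => (starRingEnd ℂ) (χ (x - y / 2)) :=
    (Complex.conjCLE : ℂ →L[ℝ] ℂ).integrable_comp h
  refine hc.bdd_mul (c := C) ?_ (Filter.Eventually.of_forall fun y => hC _)
  have := ψ.continuous
  exact Continuous.aestronglyMeasurable (by fun_prop)

lemma exists_norm_crossWigner_le {n : ℕ} (hbar : ℝ) (ψ χ : SchwartzMap (Fin n → ℝ) ℂ) :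
    ∃ C, ∀ x p, ‖crossWigner n hbar ψ χ x p‖ ≤ C := by
  obtain ⟨C, hC⟩ := exists_norm_schwartz_le ψ
  refine ⟨‖((((2 * Real.pi * hbar) ^ n)⁻¹ : ℝ) : ℂ)‖ *
    (C * ∫ t : Fin n → ℝ, ‖χ ((2⁻¹ : ℝ) • t)‖), fun x p => ?_⟩
  rw [crossWigner, norm_mul]
  gcongr
  refine (norm_integral_le_integral_norm _).trans ?_
  have hI := ((integrable_schwartz_half χ).norm.comp_sub_left ((2 : ℝ) • x)).const_mul C
  rw [← integral_sub_left_eq_self (μ := volume)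
    (fun t : Fin n → ℝ => ‖χ ((2⁻¹ : ℝ) • t)‖) ((2 : ℝ) • x), ← integral_const_mul]
  refine integral_mono_of_nonneg (Filter.Eventually.of_forall fun y => norm_nonneg _) hI
    (Filter.Eventually.of_forall fun y => ?_)
  dsimp only
  rw [norm_mul, norm_mul, norm_cexp_neg_I_mul, one_mul, RCLike.norm_conj, sub_half_eq]
  gcongr
  exact hC _

lemma aestronglyMeasurable_crossWigner {n : ℕ} (hbar : ℝ) (ψ χ : SchwartzMap (Fin n → ℝ) ℂ) :
    AEStronglyMeasurable fun w : (Fin n → ℝ) × (Fin n → ℝ) =>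
      crossWigner n hbar ψ χ w.1 w.2 := by
  unfold crossWigner
  refine AEStronglyMeasurable.const_mul ?_ _
  have hψ := ψ.continuous
  have hχ := χ.continuous
  have hcont : Continuous fun q : ((Fin n → ℝ) × (Fin n → ℝ)) × (Fin n → ℝ) =>
      Complex.exp (-(Complex.I * (((q.1.2 ⬝ᵥ q.2) / hbar : ℝ) : ℂ))) *
        ψ (q.1.1 + q.2 / 2) * (starRingEnd ℂ) (χ (q.1.1 - q.2 / 2)) := by
    have := Complex.continuous_conj
    unfold dotProduct
    fun_prop
  exact hcont.stronglyMeasurable.integral_prod_right'.aestronglyMeasurable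

lemma integrable_gaussKernel_prod (n : ℕ) {hbar : ℝ} (hhbar : 0 < hbar) :
    Integrable fun w : (Fin n → ℝ) × (Fin n → ℝ) =>
      gaussKernel n hbar w.1 * gaussKernel n hbar w.2 :=
  (integrable_gaussKernel n hhbar).mul_prod (integrable_gaussKernel n hhbar)

lemma isAddRightInvariant_volume_prod (n : ℕ) :
    (volume : Measure ((Fin n → ℝ) × (Fin n → ℝ))).IsAddRightInvariant :=
  inferInstanceAs ((volume : Measure (Fin n → ℝ)).prod volume).IsAddRightInvariant

/-- The Gaussian identity behind the factorisation of the phase-space Gaussian mean of the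
cross-Wigner transform in the coordinates `u = x + y/2`, `v = x - y/2`. -/
lemma gaussKernel_mul_cexp_mul_gaussKernel (n : ℕ) {hbar : ℝ} (hhbar : 0 < hbar)
    (z : (Fin n → ℝ) × (Fin n → ℝ)) (x y : Fin n → ℝ) :
    (((Real.pi * hbar) ^ (-(n : ℝ) / 2) : ℝ) : ℂ) * (gaussKernel n hbar (x - z.1) *
        (Complex.exp (-(Complex.I * (((z.2 ⬝ᵥ y) / hbar : ℝ) : ℂ))) *
          gaussKernel n (4 * hbar) y))
      = (starRingEnd ℂ) (heisenberg n hbar z (stdGauss n hbar) (x + y / 2)) *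
          heisenberg n hbar z (stdGauss n hbar) (x - y / 2) := by
  have hne : (hbar : ℂ) ≠ 0 := by exact_mod_cast hhbar.ne'
  have hpow : (Real.pi * hbar) ^ (-(n : ℝ) / 2)
      = (Real.pi * hbar) ^ (-(n : ℝ) / 4) * (Real.pi * hbar) ^ (-(n : ℝ) / 4) := by
    rw [← Real.rpow_add (by positivity)]
    congr 1
    ring
  have hquad : (x - z.1) ⬝ᵥ (x - z.1) / hbar + y ⬝ᵥ y / (4 * hbar)
      = (x + y / 2 - z.1) ⬝ᵥ (x + y / 2 - z.1) / (2 * hbar)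
        + (x - y / 2 - z.1) ⬝ᵥ (x - y / 2 - z.1) / (2 * hbar) := by
    simp only [dotProduct, Finset.sum_div, ← Finset.sum_add_distrib]
    refine Finset.sum_congr rfl fun i _ => ?_
    simp only [Pi.sub_apply, Pi.add_apply, Pi.div_apply, Pi.ofNat_apply]
    field_simp
    ring
  have hlin : z.2 ⬝ᵥ y = z.2 ⬝ᵥ (x + y / 2) - z.2 ⬝ᵥ (x - y / 2) := by
    rw [← dotProduct_sub]
    congr 1
    funext i
    simp
  rw [hpow]
  unfold heisenberg stdGauss gaussKernel
  simp only [map_mul, ← Complex.exp_conj, map_neg, Complex.conj_I, Complex.conj_ofReal]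
  rw [← Complex.exp_add, ← Complex.exp_add,
    show ∀ a b c d e : ℂ, Complex.exp a * (b * Complex.exp c) * (Complex.exp d *
      (b * Complex.exp e)) = (b * b) * Complex.exp (a + c + d + e) by
        intro a b c d e; simp only [Complex.exp_add]; ring]
  rw [Complex.ofReal_mul]
  congr 2
  have hquad' := congrArg (fun t : ℝ => (t : ℂ)) hquad
  rw [hlin]
  push_cast at hquad' ⊢
  linear_combination -hquad'

/-- Averaging the cross-Wigner transform over `p` against a translated Gaussian. -/
lemma integral_gaussKernel_mul_crossWigner {n : ℕ} {hbar : ℝ} (hhbar : 0 < hbar)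
    (ψ χ : SchwartzMap (Fin n → ℝ) ℂ) (x q : Fin n → ℝ) :
    ∫ p : Fin n → ℝ, gaussKernel n hbar (p - q) * crossWigner n hbar ψ χ x p
      = ((((2 * Real.pi * hbar) ^ n)⁻¹ : ℝ) : ℂ) * (((Real.pi * hbar) ^ ((n : ℝ) / 2) : ℝ) : ℂ) *
        ∫ y : Fin n → ℝ, Complex.exp (-(Complex.I * (((q ⬝ᵥ y) / hbar : ℝ) : ℂ))) *
          gaussKernel n (4 * hbar) y * (ψ (x + y / 2) * (starRingEnd ℂ) (χ (x - y / 2))) := by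
  have hint : Integrable (Function.uncurry fun p y : Fin n → ℝ =>
      gaussKernel n hbar (p - q) * (Complex.exp (-(Complex.I * (((p ⬝ᵥ y) / hbar : ℝ) : ℂ))) *
        ψ (x + y / 2) * (starRingEnd ℂ) (χ (x - y / 2)))) (volume.prod volume) := by
    have h := ((integrable_gaussKernel n hhbar).comp_sub_right q).mul_prod
      (integrable_schwartz_mul_conj ψ χ x)
    refine (h.bdd_mul (c := 1) (f := fun r : (Fin n → ℝ) × (Fin n → ℝ) =>
      Complex.exp (-(Complex.I * (((r.1 ⬝ᵥ r.2) / hbar : ℝ) : ℂ)))) ?_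
      (Filter.Eventually.of_forall fun r => (norm_cexp_neg_I_mul _).le)).congr
      (Filter.Eventually.of_forall fun r => ?_)
    · refine Continuous.aestronglyMeasurable ?_
      unfold dotProduct
      fun_prop
    · dsimp only [Function.uncurry]
      ring
  unfold crossWigner
  simp_rw [mul_left_comm (gaussKernel n hbar _), ← integral_const_mul (gaussKernel n hbar _)]
  rw [integral_const_mul, integral_integral_swap hint,
    mul_assoc ((((2 * Real.pi * hbar) ^ n)⁻¹ : ℝ) : ℂ),
    ← integral_const_mul (((Real.pi * hbar) ^ ((n : ℝ) / 2) : ℝ) : ℂ)]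
  congr 1
  refine integral_congr_ae (Filter.Eventually.of_forall fun y => ?_)
  dsimp only
  rw [← mul_assoc, ← integral_gaussKernel_sub_mul_cexp n hhbar, ← integral_mul_const]
  refine integral_congr_ae (Filter.Eventually.of_forall fun p => ?_)
  dsimp only
  ring

/-- The phase-space Gaussian mean of the cross-Wigner transform is the matrix coefficient of the
projection onto a displaced Gaussian. -/
lemma two_pow_mul_integral_gaussKernel_mul_crossWigner {n : ℕ} {hbar : ℝ} (hhbar : 0 < hbar)
    (ψ χ : SchwartzMap (Fin n → ℝ) ℂ) (z : (Fin n → ℝ) × (Fin n → ℝ)) :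
    (2 : ℂ) ^ n * ∫ w : (Fin n → ℝ) × (Fin n → ℝ),
        gaussKernel n hbar (w.1 - z.1) * gaussKernel n hbar (w.2 - z.2) *
          crossWigner n hbar ψ χ w.1 w.2
      = (∫ x : Fin n → ℝ, ψ x * (starRingEnd ℂ) (heisenberg n hbar z (stdGauss n hbar) x)) *
          (starRingEnd ℂ)
            (∫ x : Fin n → ℝ, χ x * (starRingEnd ℂ) (heisenberg n hbar z (stdGauss n hbar) x)) := by
  have := isAddRightInvariant_volume_prod n
  obtain ⟨C, hC⟩ := exists_norm_crossWigner_le hbar ψ χ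
  have hmp := measurePreserving_add_half_sub_half n
  have hint : Integrable fun w : (Fin n → ℝ) × (Fin n → ℝ) =>
      gaussKernel n hbar (w.1 - z.1) * gaussKernel n hbar (w.2 - z.2) *
        crossWigner n hbar ψ χ w.1 w.2 :=
    ((integrable_gaussKernel_prod n hhbar).comp_sub_right z).mul_bdd (c := C)
      (aestronglyMeasurable_crossWigner hbar ψ χ) (Filter.Eventually.of_forall fun w => hC _ _)
  have hconj : Integrable fun v : Fin n → ℝ => (starRingEnd ℂ) (χ v) :=
    (Complex.conjCLE : ℂ →L[ℝ] ℂ).integrable_comp χ.integrable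
  have hH : Continuous fun x => heisenberg n hbar z (stdGauss n hbar) x := by
    unfold heisenberg stdGauss dotProduct
    fun_prop
  have hψ := ψ.continuous
  have hχ := χ.continuous
  have hstar := Complex.continuous_conj
  have hprod : Integrable fun r : (Fin n → ℝ) × (Fin n → ℝ) =>
      ψ (r.1 + r.2 / 2) * (starRingEnd ℂ) (χ (r.1 - r.2 / 2)) :=
    hmp.integrable_comp_of_integrable (ψ.integrable.mul_prod hconj)
  have hint2 : Integrable fun r : (Fin n → ℝ) × (Fin n → ℝ) =>
      gaussKernel n hbar (r.1 - z.1) *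
        (Complex.exp (-(Complex.I * (((z.2 ⬝ᵥ r.2) / hbar : ℝ) : ℂ))) *
          gaussKernel n (4 * hbar) r.2 *
            (ψ (r.1 + r.2 / 2) * (starRingEnd ℂ) (χ (r.1 - r.2 / 2)))) := by
    simp_rw [← mul_assoc (gaussKernel n hbar _)]
    refine hprod.bdd_mul (c := 1) ?_ (Filter.Eventually.of_forall fun r => ?_)
    · have h1 := continuous_gaussKernel n hbar
      have h2 := continuous_gaussKernel n (4 * hbar)
      refine Continuous.aestronglyMeasurable ?_
      unfold dotProduct
      fun_prop
    · rw [norm_mul, norm_mul, norm_cexp_neg_I_mul, mul_one]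
      exact mul_le_one₀ (norm_gaussKernel_le_one n hhbar _) (norm_nonneg _)
        (norm_gaussKernel_le_one n (by positivity) _)
  have hconst : (2 : ℂ) ^ n * (((((2 * Real.pi * hbar) ^ n)⁻¹ : ℝ) : ℂ) *
      (((Real.pi * hbar) ^ ((n : ℝ) / 2) : ℝ) : ℂ))
      = (((Real.pi * hbar) ^ (-(n : ℝ) / 2) : ℝ) : ℂ) := by
    have hpos : 0 < Real.pi * hbar := by positivity
    have h : (2 : ℝ) ^ n * (((2 * Real.pi * hbar) ^ n)⁻¹ * (Real.pi * hbar) ^ ((n : ℝ) / 2))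
        = (Real.pi * hbar) ^ (-(n : ℝ) / 2) := by
      rw [mul_assoc 2, mul_pow, mul_inv, mul_assoc, mul_inv_cancel_left₀ (by positivity),
        ← Real.rpow_natCast, ← Real.rpow_neg hpos.le, ← Real.rpow_add hpos]
      congr 1
      ring
    exact_mod_cast congrArg (fun t : ℝ => (t : ℂ)) h
  rw [Measure.volume_eq_prod, integral_prod _ hint]
  simp_rw [mul_assoc (gaussKernel n hbar _), integral_const_mul (gaussKernel n hbar _),
    integral_gaussKernel_mul_crossWigner hhbar, mul_left_comm (gaussKernel n hbar _),
    ← integral_const_mul (gaussKernel n hbar _)]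
  rw [integral_const_mul, ← mul_assoc, hconst, ← integral_prod _ hint2, ← integral_const_mul,
    ← integral_conj, ← integral_prod_mul]
  rw [← Measure.volume_eq_prod]
  conv_rhs => rw [← hmp.map_eq]
  rw [integral_map hmp.aemeasurable]
  · refine integral_congr_ae (Filter.Eventually.of_forall fun r => ?_)
    have h := gaussKernel_mul_cexp_mul_gaussKernel n hhbar z r.1 r.2
    simp only [map_mul, Complex.conj_conj]
    linear_combination
      (ψ (r.1 + r.2 / 2) * (starRingEnd ℂ) (χ (r.1 - r.2 / 2))) * h
  · refine Continuous.aestronglyMeasurable ?_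
    fun_prop

/-- The anti-Wick operator `Op_AW(a) = ∫ a(z) Π̂₀(z) dz` with symbol
`a ∈ L¹(ℝ²ⁿ)` is the Weyl operator with symbol `b(w) = 2ⁿ ∫ e^{-|w-w'|²/ħ} a(w') dw'`;
in terms of matrix coefficients between Schwartz functions `ψ, χ`:
`∫ a(z)(ψ|T̂(z)φ₀) conj((χ|T̂(z)φ₀)) dz = ∫ b(w) W(ψ,χ)(w) dw`. -/
theorem toeplitz_stmt12 (n : ℕ) (hbar : ℝ) (hhbar : 0 < hbar)
    (a : ((Fin n → ℝ) × (Fin n → ℝ)) → ℂ) (ha : Integrable a)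
    (ψ χ : SchwartzMap (Fin n → ℝ) ℂ) :
    ∫ z : (Fin n → ℝ) × (Fin n → ℝ),
        a z * (∫ x : Fin n → ℝ, ψ x * (starRingEnd ℂ) (heisenberg n hbar z (stdGauss n hbar) x)) *
          (starRingEnd ℂ)
            (∫ x : Fin n → ℝ, χ x * (starRingEnd ℂ) (heisenberg n hbar z (stdGauss n hbar) x))
      = ∫ w : (Fin n → ℝ) × (Fin n → ℝ),
          ((2 : ℂ) ^ n *
            ∫ w' : (Fin n → ℝ) × (Fin n → ℝ),
              Complex.exp (-(((((w.1 - w'.1) ⬝ᵥ (w.1 - w'.1) +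
                  (w.2 - w'.2) ⬝ᵥ (w.2 - w'.2)) / hbar) : ℝ) : ℂ)) * a w') *
            crossWigner n hbar ψ χ w.1 w.2 := by
  have := isAddRightInvariant_volume_prod n
  obtain ⟨C, hC⟩ := exists_norm_crossWigner_le hbar ψ χ
  have hker : ∀ w w' : (Fin n → ℝ) × (Fin n → ℝ),
      Complex.exp (-(((((w.1 - w'.1) ⬝ᵥ (w.1 - w'.1) +
        (w.2 - w'.2) ⬝ᵥ (w.2 - w'.2)) / hbar) : ℝ) : ℂ))
      = gaussKernel n hbar (w.1 - w'.1) * gaussKernel n hbar (w.2 - w'.2) := by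
    intro w w'
    rw [gaussKernel, gaussKernel, ← Complex.exp_add]
    congr 1
    push_cast
    ring
  have hint : Integrable (Function.uncurry fun w w' : (Fin n → ℝ) × (Fin n → ℝ) =>
      crossWigner n hbar ψ χ w.1 w.2 * (a w' *
        (gaussKernel n hbar (w.1 - w'.1) * gaussKernel n hbar (w.2 - w'.2))))
      (volume.prod volume) :=
    (ha.convolution_integrand (ContinuousLinearMap.mul ℂ ℂ)
      (integrable_gaussKernel_prod n hhbar)).bdd_mul (c := C)
      (aestronglyMeasurable_crossWigner hbar ψ χ).comp_fst
      (Filter.Eventually.of_forall fun r => hC _ _)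
  have hR : ∀ w : (Fin n → ℝ) × (Fin n → ℝ),
      ((2 : ℂ) ^ n * ∫ w' : (Fin n → ℝ) × (Fin n → ℝ),
        Complex.exp (-(((((w.1 - w'.1) ⬝ᵥ (w.1 - w'.1) +
          (w.2 - w'.2) ⬝ᵥ (w.2 - w'.2)) / hbar) : ℝ) : ℂ)) * a w') *
        crossWigner n hbar ψ χ w.1 w.2
      = (2 : ℂ) ^ n * ∫ w' : (Fin n → ℝ) × (Fin n → ℝ),
        crossWigner n hbar ψ χ w.1 w.2 * (a w' *
          (gaussKernel n hbar (w.1 - w'.1) * gaussKernel n hbar (w.2 - w'.2))) := by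
    intro w
    rw [integral_const_mul]
    simp_rw [hker, mul_comm (a _)]
    ring
  simp_rw [hR]
  rw [integral_const_mul, integral_integral_swap hint, ← integral_const_mul]
  refine integral_congr_ae (Filter.Eventually.of_forall fun z => ?_)
  dsimp only
  rw [mul_assoc, ← two_pow_mul_integral_gaussKernel_mul_crossWigner hhbar, mul_left_comm,
    ← integral_const_mul]
  congr 2
  funext w
  ring
end
end
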